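/- Fix m ≥ 3. On ℝ^{2m+1} with coordinates (a_1,…,a_{m+1}, b_1,…,b_m), let π_1 be the skew-symmetric matrix-valued map determined by {a_1,b_1} = a_1, {a_j,b_j} = (1/2)a_j (2 ≤ j ≤ m), {a_{j+1},b_j} = −(1/2)a_{j+1} (1 ≤ j ≤ m−1), {a_{m+1},b_m} = −a_{m+1}, all other brackets zero; and let π_3 be the skew-symmetric matrix-valued map determined by {a_i,a_{i+1}} = a_i a_{i+1} b_i for 2 ≤ i ≤ m−1; {a_1,a_2} = 2a_1a_2b_1 and {a_m,a_{m+1}} = 2a_ma_{m+1}b_m; {b_i,b_{i+1}} = 2a_{i+1}²(b_i + b_{i+1}) for 1 ≤ i ≤ m−1; {a_1,b_1} = 2a_1(a_1² + b_1²); {a_i,b_i} = a_i(a_i² + b_i²) for 2 ≤ i ≤ m−1; {a_m,b_m} = a_m(a_m² + b_m² − a_{m+1}²); {a_1,b_2} = 2a_2²a_1; {a_i,b_{i+1}} = a_{i+1}²a_i for 2 ≤ i ≤ m−1; {a_2,b_1} = −a_2(a_2² + b_1² − a_1²); {a_{i+1},b_i} = −a_{i+1}(a_{i+1}² + b_i²)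 for 2 ≤ i ≤ m−1; {a_{m+1},b_m} = −2a_{m+1}(a_{m+1}² + b_m²); {a_{i+2},b_i} = −a_{i+1}²a_{i+2} for 1 ≤ i ≤ m−2; {a_{m+1},b_{m−1}} = −2a_m²a_{m+1}; all other brackets zero. Then π_3 is a Poisson tensor (it satisfies the Jacobi identity) and π_1 and π_3 are compatible (π_1 + π_3 also satisfies the Jacobi identity). -/

import Mathlib

/-- The `a`-coordinates (1-based `j`, `1 ≤ j ≤ m+1`) on `ℝ^{2m+1}` with coordinates
`(a_1, …, a_{m+1}, b_1, …, b_m)`. -/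
noncomputable def aV (m : ℕ) (x : Fin (2*m+1) → ℝ) (j : ℕ) : ℝ :=
  if h : 1 ≤ j ∧ j ≤ m + 1 then x ⟨j - 1, by omega⟩ else 0

/-- The `b`-coordinates (1-based `j`, `1 ≤ j ≤ m`) on `ℝ^{2m+1}`. -/
noncomputable def bV (m : ℕ) (x : Fin (2*m+1) → ℝ) (j : ℕ) : ℝ :=
  if h : 1 ≤ j ∧ j ≤ m then x ⟨m + j, by omega⟩ else 0

/-- The linear bracket `{a_i, b_j}` of `π₁`: `{a_1,b_1} = a_1`, `{a_j,b_j} = (1/2)a_j`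
(`2 ≤ j ≤ m`), `{a_{j+1},b_j} = -(1/2)a_{j+1}` (`1 ≤ j ≤ m-1`), `{a_{m+1},b_m} = -a_{m+1}`. -/
noncomputable def pi1ab (m : ℕ) (x : Fin (2*m+1) → ℝ) (i j : ℕ) : ℝ :=
  if i = 1 ∧ j = 1 then aV m x 1
  else if 2 ≤ i ∧ i ≤ m ∧ j = i then (1/2) * aV m x i
  else if i = j + 1 ∧ 1 ≤ j ∧ j ≤ m - 1 then -((1/2) * aV m x i)
  else if i = m + 1 ∧ j = m then -(aV m x (m+1))
  else 0

/-- The skew-symmetric Poisson matrix `π₁` on `ℝ^{2m+1}`; the first `m+1` (0-based)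
indices are the `a`-coordinates, the last `m` are the `b`-coordinates. -/
noncomputable def pi1M (m : ℕ) (x : Fin (2*m+1) → ℝ) :
    Matrix (Fin (2*m+1)) (Fin (2*m+1)) ℝ :=
  fun p q =>
    if (p : ℕ) ≤ m ∧ m < (q : ℕ) then pi1ab m x ((p : ℕ) + 1) ((q : ℕ) - m)
    else if (q : ℕ) ≤ m ∧ m < (p : ℕ) then -(pi1ab m x ((q : ℕ) + 1) ((p : ℕ) - m))
    else 0

/-- The cubic bracket `{a_i, a_j}` (for `i < j`) of `π₃`. -/
noncomputable def pi3aa (m : ℕ) (x : Fin (2*m+1) → ℝ) (i j : ℕ) : ℝ :=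
  if i = 1 ∧ j = 2 then 2 * aV m x 1 * aV m x 2 * bV m x 1
  else if 2 ≤ i ∧ i ≤ m - 1 ∧ j = i + 1 then aV m x i * aV m x (i+1) * bV m x i
  else if i = m ∧ j = m + 1 then 2 * aV m x m * aV m x (m+1) * bV m x m
  else 0

/-- The cubic bracket `{b_i, b_j}` (for `i < j`) of `π₃`:
`{b_i, b_{i+1}} = 2a_{i+1}²(b_i + b_{i+1})` for `1 ≤ i ≤ m-1`. -/
noncomputable def pi3bb (m : ℕ) (x : Fin (2*m+1) → ℝ) (i j : ℕ) : ℝ :=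
  if 1 ≤ i ∧ i ≤ m - 1 ∧ j = i + 1 then 2 * (aV m x (i+1))^2 * (bV m x i + bV m x (i+1))
  else 0

/-- The cubic bracket `{a_i, b_j}` of `π₃`. -/
noncomputable def pi3ab (m : ℕ) (x : Fin (2*m+1) → ℝ) (i j : ℕ) : ℝ :=
  if i = 1 ∧ j = 1 then 2 * aV m x 1 * ((aV m x 1)^2 + (bV m x 1)^2)
  else if 2 ≤ i ∧ i ≤ m - 1 ∧ j = i then aV m x i * ((aV m x i)^2 + (bV m x i)^2)
  else if i = m ∧ j = m then aV m x m * ((aV m x m)^2 + (bV m x m)^2 - (aV m x (m+1))^2)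
  else if i = 1 ∧ j = 2 then 2 * (aV m x 2)^2 * aV m x 1
  else if 2 ≤ i ∧ i ≤ m - 1 ∧ j = i + 1 then (aV m x (i+1))^2 * aV m x i
  else if i = 2 ∧ j = 1 then -(aV m x 2 * ((aV m x 2)^2 + (bV m x 1)^2 - (aV m x 1)^2))
  else if 2 ≤ j ∧ j ≤ m - 1 ∧ i = j + 1 then -(aV m x i * ((aV m x i)^2 + (bV m x j)^2))
  else if i = m + 1 ∧ j = m then -(2 * aV m x (m+1) * ((aV m x (m+1))^2 + (bV m x m)^2))
  else if 1 ≤ j ∧ j ≤ m - 2 ∧ i = j + 2 then -((aV m x (j+1))^2 * aV m x i)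
  else if i = m + 1 ∧ j = m - 1 then -(2 * (aV m x m)^2 * aV m x (m+1))
  else 0

/-- The skew-symmetric cubic Poisson matrix `π₃` on `ℝ^{2m+1}`; the first `m+1` (0-based)
indices are the `a`-coordinates, the last `m` are the `b`-coordinates. -/
noncomputable def pi3M (m : ℕ) (x : Fin (2*m+1) → ℝ) :
    Matrix (Fin (2*m+1)) (Fin (2*m+1)) ℝ :=
  fun p q =>
    if (p : ℕ) ≤ m ∧ (q : ℕ) ≤ m then
      (if (p : ℕ) < (q : ℕ) then pi3aa m x ((p : ℕ) + 1) ((q : ℕ) + 1)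
        else if (q : ℕ) < (p : ℕ) then -(pi3aa m x ((q : ℕ) + 1) ((p : ℕ) + 1)) else 0)
    else if (p : ℕ) ≤ m ∧ m < (q : ℕ) then pi3ab m x ((p : ℕ) + 1) ((q : ℕ) - m)
    else if (q : ℕ) ≤ m ∧ m < (p : ℕ) then -(pi3ab m x ((q : ℕ) + 1) ((p : ℕ) - m))
    else
      (if (p : ℕ) < (q : ℕ) then pi3bb m x ((p : ℕ) - m) ((q : ℕ) - m)
        else if (q : ℕ) < (p : ℕ) then -(pi3bb m x ((q : ℕ) - m) ((p : ℕ) - m)) else 0)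


/-! ### Uniform description of the pencil -/

/-- weight of `a_i`: `2` at the two ends, `1` inside. -/
noncomputable def wt (m i : ℕ) : ℝ := if i = 1 ∨ i = m + 1 then 2 else 1
/-- indicator of the left end. -/
noncomputable def lft (i : ℕ) : ℝ := if i = 1 then 1 else 0
/-- indicator of the right end. -/
noncomputable def rgt (m i : ℕ) : ℝ := if i = m + 1 then 1 else 0

/-- uniform `{a_i,a_j}`. -/
noncomputable def uAA (m : ℕ) (a b : ℕ → ℝ) (i j : ℕ) : ℝ :=
  if j = i + 1 then wt m i * wt m j * (a i * a j * b i)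
  else if i = j + 1 then -(wt m j * wt m i * (a j * a i * b j))
  else 0

/-- uniform `{a_i,b_j}`, for `π₃ + 2 t π₁`. -/
noncomputable def uAB (m : ℕ) (t : ℝ) (a b : ℕ → ℝ) (i j : ℕ) : ℝ :=
  if i = j then wt m i * (a i * (a i * a i + b j * b j + t)) - rgt m (j+1) * (a i * (a (j+1) * a (j+1)))
  else if i = j + 1 then
    -(wt m i * (a i * (a i * a i + b j * b j + t))) + lft j * (a j * a j * a i)
  else if j = i + 1 then wt m i * (a j * a j * a i)
  else if i = j + 2 then -(wt m i * (a (j+1) * a (j+1) * a i))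
  else 0

/-- uniform `{b_i,b_j}`. -/
noncomputable def uBB (a b : ℕ → ℝ) (i j : ℕ) : ℝ :=
  if j = i + 1 then 2 * (a j * a j * (b i + b j))
  else if i = j + 1 then -(2 * (a i * a i * (b j + b i)))
  else 0

/-- derivative of `uAA` in the direction `(c, d)`. -/
noncomputable def dAA (m : ℕ) (a b c d : ℕ → ℝ) (i j : ℕ) : ℝ :=
  if j = i + 1 then wt m i * wt m j * (c i * a j * b i + a i * c j * b i + a i * a j * d i)
  else if i = j + 1 then
    -(wt m j * wt m i * (c j * a i * b j + a j * c i * b j + a j * a i * d j))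
  else 0

/-- derivative of `uAB` in the direction `(c, d)`. -/
noncomputable def dAB (m : ℕ) (t : ℝ) (a b c d : ℕ → ℝ) (i j : ℕ) : ℝ :=
  if i = j then wt m i * (c i * (a i * a i + b j * b j + t) + a i * (2 * a i * c i + 2 * b j * d j))
      - rgt m (j+1) * (c i * (a (j+1) * a (j+1)) + a i * (2 * a (j+1) * c (j+1)))
  else if i = j + 1 then
    -(wt m i * (c i * (a i * a i + b j * b j + t) + a i * (2 * a i * c i + 2 * b j * d j)))
      + lft j * (2 * a j * c j * a i + a j * a j * c i)
  else if j = i + 1 then wt m i * (2 * a j * c j * a i + a j * a j * c i)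
  else if i = j + 2 then -(wt m i * (2 * a (j+1) * c (j+1) * a i + a (j+1) * a (j+1) * c i))
  else 0

/-- derivative of `uBB` in the direction `(c, d)`. -/
noncomputable def dBB (a b c d : ℕ → ℝ) (i j : ℕ) : ℝ :=
  if j = i + 1 then 2 * (2 * a j * c j * (b i + b j) + a j * a j * (d i + d j))
  else if i = j + 1 then -(2 * (2 * a i * c i * (b j + b i) + a i * a i * (d j + d i)))
  else 0

theorem uAA_antisymm (m : ℕ) (a b : ℕ → ℝ) (i j : ℕ) : uAA m a b i j = - uAA m a b j i := by
  unfold uAA; split_ifs <;> first | omega | ring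

theorem uBB_antisymm (a b : ℕ → ℝ) (i j : ℕ) : uBB a b i j = - uBB a b j i := by
  unfold uBB; split_ifs <;> first | omega | ring

theorem dAA_antisymm (m : ℕ) (a b c d : ℕ → ℝ) (i j : ℕ) :
    dAA m a b c d i j = - dAA m a b c d j i := by
  unfold dAA; split_ifs <;> first | omega | ring

theorem dBB_antisymm (a b c d : ℕ → ℝ) (i j : ℕ) :
    dBB a b c d i j = - dBB a b c d j i := by
  unfold dBB; split_ifs <;> first | omega | ring

theorem wt_one (m i : ℕ) (h : i = 1) : wt m i = 2 := by simp [wt, h]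
theorem wt_last (m i : ℕ) (h : i = m + 1) : wt m i = 2 := by simp [wt, h]
theorem wt_mid (m i : ℕ) (h : i ≠ 1) (h' : i ≠ m + 1) : wt m i = 1 := by simp [wt, h, h']
theorem lft_one (i : ℕ) (h : i = 1) : lft i = 1 := by simp [lft, h]
theorem lft_ne (i : ℕ) (h : i ≠ 1) : lft i = 0 := by simp [lft, h]
theorem rgt_last (m i : ℕ) (h : i = m + 1) : rgt m i = 1 := by simp [rgt, h]
theorem rgt_ne (m i : ℕ) (h : i ≠ m + 1) : rgt m i = 0 := by simp [rgt, h]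

set_option linter.unusedSimpArgs false in
theorem jac_aaa_lt (m : ℕ) (hm : 3 ≤ m) (t : ℝ) (a b : ℕ → ℝ) (i j k : ℕ)
    (hi : 1 ≤ i) (hij : i < j) (hjk : j < k) (hk' : k ≤ m+1) :
    dAA m a b (fun n => uAA m a b n i) (fun n => - uAB m t a b i n) j k
    + dAA m a b (fun n => uAA m a b n j) (fun n => - uAB m t a b j n) k i
    + dAA m a b (fun n => uAA m a b n k) (fun n => - uAB m t a b k n) i j = 0 := by
  by_cases h1 : j = i + 1 <;> by_cases h2 : k = j + 1 <;> try subst h2 <;> try subst h1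
  · rcases Nat.lt_or_ge 1 i with hi1 | hi1 <;>
    rcases Nat.lt_or_ge i (m-1) with hi2 | hi2 <;>
    first
    | omega
    | (simp (disch := omega) only [dAA, uAA, uAB, if_pos, if_neg, if_true, if_false, wt_one, wt_last,
        wt_mid, lft_one, lft_ne, rgt_last, rgt_ne]; ring)
  all_goals
    simp (disch := omega) only [dAA, uAA, uAB, if_pos, if_neg, if_true, if_false] ; ring

set_option linter.unusedSimpArgs false in
theorem jac_bbb_lt (m : ℕ) (hm : 3 ≤ m) (t : ℝ) (a b : ℕ → ℝ) (i j k : ℕ)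
    (hi : 1 ≤ i) (hij : i < j) (hjk : j < k) (hk' : k ≤ m) :
    dBB a b (fun n => uAB m t a b n i) (fun n => uBB a b n i) j k
    + dBB a b (fun n => uAB m t a b n j) (fun n => uBB a b n j) k i
    + dBB a b (fun n => uAB m t a b n k) (fun n => uBB a b n k) i j = 0 := by
  by_cases h1 : j = i + 1 <;> by_cases h2 : k = j + 1 <;> try subst h2 <;> try subst h1
  · rcases Nat.lt_or_ge 1 i with hi1 | hi1 <;>
    rcases Nat.lt_or_ge i (m-2) with hi2 | hi2 <;>
    first
    | omega
    | (simp (disch := omega) only [dBB, uBB, uAB, if_pos, if_neg, if_true, if_false, wt_one, wt_last,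
        wt_mid, lft_one, lft_ne, rgt_last, rgt_ne]; ring)
  · by_cases h3 : k = i + 3
    · subst h3
      simp (disch := omega) only [dBB, uBB, uAB, if_pos, if_neg, if_true, if_false] ; ring
    · simp (disch := omega) only [dBB, uBB, uAB, if_pos, if_neg, if_true, if_false] ; ring
  · by_cases h3 : j = i + 2
    · subst h3
      simp (disch := omega) only [dBB, uBB, uAB, if_pos, if_neg, if_true, if_false] ; ring
    · simp (disch := omega) only [dBB, uBB, uAB, if_pos, if_neg, if_true, if_false] ; ring
  · simp (disch := omega) only [dBB, uBB, uAB, if_pos, if_neg, if_true, if_false] ; ring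

set_option linter.unusedSimpArgs false in
set_option maxHeartbeats 4000000 in
theorem jac_aab_lt (m : ℕ) (hm : 3 ≤ m) (t : ℝ) (a b : ℕ → ℝ) (i j k : ℕ)
    (hi : 1 ≤ i) (hij : i < j) (hj' : j ≤ m+1) (hk : 1 ≤ k) (hk' : k ≤ m) :
    dAB m t a b (fun n => uAA m a b n i) (fun n => - uAB m t a b i n) j k
    - dAB m t a b (fun n => uAA m a b n j) (fun n => - uAB m t a b j n) i k
    + dAA m a b (fun n => uAB m t a b n k) (fun n => uBB a b n k) i j = 0 := by
  have H1 : i = k ∨ i = k + 1 ∨ k = i + 1 ∨ i = k + 2 ∨ (i ≠ k ∧ i ≠ k + 1 ∧ k ≠ i + 1 ∧ i ≠ k + 2) := by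
    omega
  have H2 : j = k ∨ j = k + 1 ∨ k = j + 1 ∨ j = k + 2 ∨ (j ≠ k ∧ j ≠ k + 1 ∧ k ≠ j + 1 ∧ j ≠ k + 2) := by
    omega
  have H4 : 1 < i ∨ i = 1 := by omega
  have H5 : j < m + 1 ∨ j = m + 1 := by omega
  have H6 : 1 < k ∨ k = 1 := by omega
  have H7 : k < m ∨ k = m := by omega
  rcases H1 with h1 | h1 | h1 | h1 | h1 <;> rcases H2 with h2 | h2 | h2 | h2 | h2 <;>
  by_cases h3 : j = i + 1 <;> try omega
  all_goals
    (try subst h1) <;> (try subst h2) <;> (try subst h3) <;>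
    simp (disch := omega) only [dAA, dAB, uBB, uAA, uAB, if_pos, if_neg, if_true, if_false,
        wt_mid, lft_ne, rgt_ne] <;>
    try ring1
  all_goals
    rcases H4 with h4 | h4 <;> rcases H5 with h5 | h5 <;> rcases H6 with h6 | h6 <;>
    rcases H7 with h7 | h7 <;>
    first
    | omega
    | (simp (disch := omega) only [if_pos, if_neg, if_true, if_false, wt_one, wt_last,
        wt_mid, lft_one, lft_ne, rgt_last, rgt_ne] ; try ring1)

set_option linter.unusedSimpArgs false in
set_option maxHeartbeats 4000000 in
theorem jac_abb_lt (m : ℕ) (hm : 3 ≤ m) (t : ℝ) (a b : ℕ → ℝ) (i j k : ℕ)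
    (hi : 1 ≤ i) (hi' : i ≤ m + 1) (hj : 1 ≤ j) (hjk : j < k) (hk' : k ≤ m) :
    dBB a b (fun n => uAA m a b n i) (fun n => - uAB m t a b i n) j k
    - dAB m t a b (fun n => uAB m t a b n j) (fun n => uBB a b n j) i k
    + dAB m t a b (fun n => uAB m t a b n k) (fun n => uBB a b n k) i j = 0 := by
  have H1 : i = k ∨ i = k + 1 ∨ k = i + 1 ∨ i = k + 2 ∨ (i ≠ k ∧ i ≠ k + 1 ∧ k ≠ i + 1 ∧ i ≠ k + 2) := by
    omega
  have H2 : i = j ∨ i = j + 1 ∨ j = i + 1 ∨ i = j + 2 ∨ (i ≠ j ∧ i ≠ j + 1 ∧ j ≠ i + 1 ∧ i ≠ j + 2) := by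
    omega
  have H4 : 1 < i ∨ i = 1 := by omega
  have H5 : i < m + 1 ∨ i = m + 1 := by omega
  have H6 : 1 < j ∨ j = 1 := by omega
  have H7 : k < m ∨ k = m := by omega
  rcases H2 with h1 | h1 | h1 | h1 | h1 <;> rcases H1 with h2 | h2 | h2 | h2 | h2 <;>
  by_cases h3 : k = j + 1 <;> try omega
  all_goals
    (try subst h1) <;> (try subst h2) <;> (try subst h3) <;>
    simp (disch := omega) only [dBB, dAB, uBB, uAA, uAB, if_pos, if_neg, if_true, if_false,
        wt_mid, lft_ne, rgt_ne] <;>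
    try ring1
  all_goals
    rcases H4 with h4 | h4 <;> rcases H5 with h5 | h5 <;> rcases H6 with h6 | h6 <;>
    rcases H7 with h7 | h7 <;>
    first
    | omega
    | (simp (disch := omega) only [if_pos, if_neg, if_true, if_false, wt_one, wt_last,
        wt_mid, lft_one, lft_ne, rgt_last, rgt_ne] ; try ring1)

/-! ### Removing the ordering assumptions -/

theorem cyc_of_lt (T : ℕ → ℕ → ℕ → ℝ) (N : ℕ) (hT : ∀ i j k, T i j k = - T i k j)
    (h : ∀ i j k, 1 ≤ i → i < j → j < k → k ≤ N → T i j k + T j k i + T k i j = 0)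
    (i j k : ℕ) (hi : 1 ≤ i) (hj : 1 ≤ j) (hk : 1 ≤ k) (hi' : i ≤ N) (hj' : j ≤ N) (hk' : k ≤ N) :
    T i j k + T j k i + T k i j = 0 := by
  have e1 := hT i j k
  have e2 := hT j k i
  have e3 := hT k i j
  rcases lt_trichotomy i j with h1 | h1 | h1
  · rcases lt_trichotomy j k with h2 | h2 | h2
    · exact h i j k hi h1 h2 hk'
    · subst h2; linarith
    · rcases lt_trichotomy i k with h3 | h3 | h3
      · linarith [h i k j hi h3 h2 hj']
      · subst h3; linarith
      · linarith [h k i j hk h3 h1 hj']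
  · subst h1; linarith
  · rcases lt_trichotomy i k with h2 | h2 | h2
    · linarith [h j i k hj h1 h2 hk']
    · subst h2; linarith
    · rcases lt_trichotomy j k with h3 | h3 | h3
      · linarith [h j k i hj h3 h2 hi']
      · subst h3; linarith
      · linarith [h k j i hk h3 h1 hi']

theorem jac_aaa (m : ℕ) (hm : 3 ≤ m) (t : ℝ) (a b : ℕ → ℝ) (i j k : ℕ)
    (hi : 1 ≤ i) (hj : 1 ≤ j) (hk : 1 ≤ k) (hi' : i ≤ m+1) (hj' : j ≤ m+1) (hk' : k ≤ m+1) :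
    dAA m a b (fun n => uAA m a b n i) (fun n => - uAB m t a b i n) j k
    + dAA m a b (fun n => uAA m a b n j) (fun n => - uAB m t a b j n) k i
    + dAA m a b (fun n => uAA m a b n k) (fun n => - uAB m t a b k n) i j = 0 :=
  cyc_of_lt (fun i j k => dAA m a b (fun n => uAA m a b n i) (fun n => - uAB m t a b i n) j k)
    (m+1) (fun _ _ _ => dAA_antisymm _ _ _ _ _ _ _) (fun i j k => jac_aaa_lt m hm t a b i j k)
    i j k hi hj hk hi' hj' hk'

theorem jac_bbb (m : ℕ) (hm : 3 ≤ m) (t : ℝ) (a b : ℕ → ℝ) (i j k : ℕ)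
    (hi : 1 ≤ i) (hj : 1 ≤ j) (hk : 1 ≤ k) (hi' : i ≤ m) (hj' : j ≤ m) (hk' : k ≤ m) :
    dBB a b (fun n => uAB m t a b n i) (fun n => uBB a b n i) j k
    + dBB a b (fun n => uAB m t a b n j) (fun n => uBB a b n j) k i
    + dBB a b (fun n => uAB m t a b n k) (fun n => uBB a b n k) i j = 0 :=
  cyc_of_lt (fun i j k => dBB a b (fun n => uAB m t a b n i) (fun n => uBB a b n i) j k)
    m (fun _ _ _ => dBB_antisymm _ _ _ _ _ _) (fun i j k => jac_bbb_lt m hm t a b i j k)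
    i j k hi hj hk hi' hj' hk'

theorem jac_aab (m : ℕ) (hm : 3 ≤ m) (t : ℝ) (a b : ℕ → ℝ) (i j k : ℕ)
    (hi : 1 ≤ i) (hj : 1 ≤ j) (hi' : i ≤ m+1) (hj' : j ≤ m+1) (hk : 1 ≤ k) (hk' : k ≤ m) :
    dAB m t a b (fun n => uAA m a b n i) (fun n => - uAB m t a b i n) j k
    - dAB m t a b (fun n => uAA m a b n j) (fun n => - uAB m t a b j n) i k
    + dAA m a b (fun n => uAB m t a b n k) (fun n => uBB a b n k) i j = 0 := by
  have e := dAA_antisymm m a b (fun n => uAB m t a b n k) (fun n => uBB a b n k) i j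
  rcases lt_trichotomy i j with h1 | h1 | h1
  · exact jac_aab_lt m hm t a b i j k hi h1 hj' hk hk'
  · subst h1; linarith
  · linarith [jac_aab_lt m hm t a b j i k hj h1 hi' hk hk']

theorem jac_abb (m : ℕ) (hm : 3 ≤ m) (t : ℝ) (a b : ℕ → ℝ) (i j k : ℕ)
    (hi : 1 ≤ i) (hi' : i ≤ m + 1) (hj : 1 ≤ j) (hj' : j ≤ m) (hk : 1 ≤ k) (hk' : k ≤ m) :
    dBB a b (fun n => uAA m a b n i) (fun n => - uAB m t a b i n) j k
    - dAB m t a b (fun n => uAB m t a b n j) (fun n => uBB a b n j) i k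
    + dAB m t a b (fun n => uAB m t a b n k) (fun n => uBB a b n k) i j = 0 := by
  have e := dBB_antisymm a b (fun n => uAA m a b n i) (fun n => - uAB m t a b i n) j k
  rcases lt_trichotomy j k with h1 | h1 | h1
  · exact jac_abb_lt m hm t a b i j k hi hi' hj h1 hk'
  · subst h1; linarith
  · linarith [jac_abb_lt m hm t a b i k j hi hi' hk h1 hj']

/-! ### The full matrices -/

/-- uniform description of the matrix of `π₃ + 2 t π₁`. -/
noncomputable def uM (m : ℕ) (t : ℝ) (a b : ℕ → ℝ) (p q : ℕ) : ℝ :=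
  if p ≤ m then (if q ≤ m then uAA m a b (p+1) (q+1) else uAB m t a b (p+1) (q-m))
  else (if q ≤ m then - uAB m t a b (q+1) (p-m) else uBB a b (p-m) (q-m))

/-- its derivative in the direction `(c, d)`. -/
noncomputable def dM (m : ℕ) (t : ℝ) (a b c d : ℕ → ℝ) (p q : ℕ) : ℝ :=
  if p ≤ m then (if q ≤ m then dAA m a b c d (p+1) (q+1) else dAB m t a b c d (p+1) (q-m))
  else (if q ≤ m then - dAB m t a b c d (q+1) (p-m) else dBB a b c d (p-m) (q-m))

set_option linter.unusedSimpArgs false in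
set_option maxHeartbeats 2000000 in
theorem pi3aa_eq (m : ℕ) (hm : 3 ≤ m) (x : Fin (2*m+1) → ℝ) (i j : ℕ) (hi : 1 ≤ i)
    (hij : i < j) (hj : j ≤ m + 1) :
    pi3aa m x i j = uAA m (aV m x) (bV m x) i j := by
  by_cases h : j = i + 1
  · subst h
    have H : i = 1 ∨ i = m ∨ (2 ≤ i ∧ i ≤ m - 1) := by omega
    rcases H with h | h | h <;> try subst h
    all_goals
      simp (disch := omega) only [pi3aa, uAA, if_pos, if_neg, if_true, if_false,
        and_true, true_and, and_self, Nat.reduceAdd, wt_one, wt_last, wt_mid]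
      ring
  · simp (disch := omega) only [pi3aa, uAA, if_neg]

set_option linter.unusedSimpArgs false in
set_option maxHeartbeats 2000000 in
theorem pi3bb_eq (m : ℕ) (x : Fin (2*m+1) → ℝ) (i j : ℕ) (hi : 1 ≤ i)
    (hij : i < j) (hj : j ≤ m) :
    pi3bb m x i j = uBB (aV m x) (bV m x) i j := by
  by_cases h : j = i + 1
  · subst h
    simp (disch := omega) only [pi3bb, uBB, if_pos, if_true, and_true]
    ring
  · simp (disch := omega) only [pi3bb, uBB, if_neg]

set_option linter.unusedSimpArgs false in
set_option maxHeartbeats 2000000 in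
theorem piab_eq (m : ℕ) (hm : 3 ≤ m) (x : Fin (2*m+1) → ℝ) (i j : ℕ) (hi : 1 ≤ i)
    (hi' : i ≤ m + 1) (hj : 1 ≤ j) (hj' : j ≤ m) :
    pi3ab m x i j = uAB m 0 (aV m x) (bV m x) i j ∧
    pi1ab m x i j + pi3ab m x i j = uAB m (1/2) (aV m x) (bV m x) i j := by
  have H : i = j ∨ i = j + 1 ∨ j = i + 1 ∨ i = j + 2 ∨
      (i ≠ j ∧ i ≠ j + 1 ∧ j ≠ i + 1 ∧ i ≠ j + 2) := by omega
  have H4 : i = 1 ∨ 2 ≤ i := by omega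
  have H6 : j = 1 ∨ 2 ≤ j := by omega
  have H5 : j = m ∨ j + 1 = m ∨ j ≤ m - 2 := by omega
  rcases H with h | h | h | h | h <;> rcases H4 with h4 | h4 <;> rcases H6 with h6 | h6 <;>
  rcases H5 with h5 | h5 | h5 <;> try omega
  all_goals
    try subst h
    try subst h5
    try subst h4
    try subst h6
    simp (disch := omega) only [pi3ab, pi1ab, uAB, if_pos, if_neg, if_true, if_false, wt_one,
      and_true, true_and, and_self, Nat.reduceAdd,
      wt_last, wt_mid, lft_one, lft_ne, rgt_last, rgt_ne, Nat.add_sub_cancel]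
    try first | ring1 | (constructor <;> ring1)

theorem pi3M_eq (m : ℕ) (hm : 3 ≤ m) (x : Fin (2*m+1) → ℝ) (p q : Fin (2*m+1)) :
    pi3M m x p q = uM m 0 (aV m x) (bV m x) p q ∧
    pi1M m x p q + pi3M m x p q = uM m (1/2) (aV m x) (bV m x) p q := by
  obtain ⟨p, hp⟩ := p
  obtain ⟨q, hq⟩ := q
  by_cases h1 : p ≤ m <;> by_cases h2 : q ≤ m
  · simp (disch := omega) only [pi3M, pi1M, uM, if_pos, if_neg, if_true]
    rw [zero_add, and_self]
    rcases lt_trichotomy p q with h | h | h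
    · rw [if_pos h, pi3aa_eq m hm x _ _ (by omega) (by omega) (by omega)]
    · subst h
      simp [uAA]
    · rw [if_neg (by omega), if_pos h, pi3aa_eq m hm x _ _ (by omega) (by omega) (by omega),
        uAA_antisymm]
      ring
  · simp (disch := omega) only [pi3M, pi1M, uM, if_pos, if_neg, if_true]
    exact piab_eq m hm x _ _ (by omega) (by omega) (by omega) (by omega)
  · simp (disch := omega) only [pi3M, pi1M, uM, if_pos, if_neg, if_true]
    have := piab_eq m hm x (q+1) (p-m) (by omega) (by omega) (by omega) (by omega)
    constructor <;> linarith [this.1, this.2]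
  · simp (disch := omega) only [pi3M, pi1M, uM, if_neg]
    rw [zero_add, and_self]
    rcases lt_trichotomy p q with h | h | h
    · rw [if_pos h, pi3bb_eq m x _ _ (by omega) (by omega) (by omega)]
    · subst h
      simp [uBB]
    · rw [if_neg (by omega), if_pos h, pi3bb_eq m x _ _ (by omega) (by omega) (by omega),
        uBB_antisymm]
      ring

/-! ### Derivatives -/

/-- `f` is differentiable at `x` and its derivative in the direction `v` is `d`. -/
def HasDir {n : ℕ} (f : (Fin n → ℝ) → ℝ) (x v : Fin n → ℝ) (d : ℝ) : Prop :=
  ∃ L : (Fin n → ℝ) →L[ℝ] ℝ, HasFDerivAt f L x ∧ L v = d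

theorem HasDir.const {n : ℕ} (r : ℝ) (x v : Fin n → ℝ) : HasDir (fun _ => r) x v 0 :=
  ⟨0, hasFDerivAt_const r x, rfl⟩

theorem HasDir.add {n : ℕ} {f g : (Fin n → ℝ) → ℝ} {x v : Fin n → ℝ} {d e : ℝ}
    (hf : HasDir f x v d) (hg : HasDir g x v e) : HasDir (fun y => f y + g y) x v (d + e) := by
  obtain ⟨L, hL, rfl⟩ := hf
  obtain ⟨K, hK, rfl⟩ := hg
  exact ⟨L + K, hL.add hK, rfl⟩

theorem HasDir.sub {n : ℕ} {f g : (Fin n → ℝ) → ℝ} {x v : Fin n → ℝ} {d e : ℝ}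
    (hf : HasDir f x v d) (hg : HasDir g x v e) : HasDir (fun y => f y - g y) x v (d - e) := by
  obtain ⟨L, hL, rfl⟩ := hf
  obtain ⟨K, hK, rfl⟩ := hg
  exact ⟨L - K, hL.sub hK, rfl⟩

theorem HasDir.neg {n : ℕ} {f : (Fin n → ℝ) → ℝ} {x v : Fin n → ℝ} {d : ℝ}
    (hf : HasDir f x v d) : HasDir (fun y => - f y) x v (-d) := by
  obtain ⟨L, hL, rfl⟩ := hf
  exact ⟨-L, hL.neg, rfl⟩

theorem HasDir.mul {n : ℕ} {f g : (Fin n → ℝ) → ℝ} {x v : Fin n → ℝ} {d e : ℝ}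
    (hf : HasDir f x v d) (hg : HasDir g x v e) :
    HasDir (fun y => f y * g y) x v (d * g x + f x * e) := by
  obtain ⟨L, hL, rfl⟩ := hf
  obtain ⟨K, hK, rfl⟩ := hg
  refine ⟨_, hL.mul hK, ?_⟩
  simp
  ring

theorem HasDir.cmul {n : ℕ} {f : (Fin n → ℝ) → ℝ} {x v : Fin n → ℝ} {d : ℝ} (r : ℝ)
    (hf : HasDir f x v d) : HasDir (fun y => r * f y) x v (r * d) := by
  have := (HasDir.const r x v).mul hf
  simpa using this

theorem HasDir.congr_val {n : ℕ} {f : (Fin n → ℝ) → ℝ} {x v : Fin n → ℝ} {d e : ℝ}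
    (hf : HasDir f x v d) (h : d = e) : HasDir f x v e := h ▸ hf

theorem HasDir.coord {n : ℕ} (l : Fin n) (x v : Fin n → ℝ) : HasDir (fun y => y l) x v (v l) :=
  ⟨ContinuousLinearMap.proj l, (ContinuousLinearMap.proj (R := ℝ) (φ := fun _ : Fin n => ℝ) l).hasFDerivAt, rfl⟩

theorem hasDir_aV (m : ℕ) (x v : Fin (2*m+1) → ℝ) (j : ℕ) :
    HasDir (fun y => aV m y j) x v (aV m v j) := by
  unfold aV
  split_ifs
  · exact HasDir.coord _ x v
  · exact HasDir.const _ x v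

theorem hasDir_bV (m : ℕ) (x v : Fin (2*m+1) → ℝ) (j : ℕ) :
    HasDir (fun y => bV m y j) x v (bV m v j) := by
  unfold bV
  split_ifs
  · exact HasDir.coord _ x v
  · exact HasDir.const _ x v

theorem hasDir_uAA (m : ℕ) (x v : Fin (2*m+1) → ℝ) (i j : ℕ) :
    HasDir (fun y => uAA m (aV m y) (bV m y) i j) x v
      (dAA m (aV m x) (bV m x) (aV m v) (bV m v) i j) := by
  have A := hasDir_aV m x v
  have B := hasDir_bV m x v
  unfold uAA dAA
  split_ifs
  · exact ((((A i).mul (A j)).mul (B i)).cmul _).congr_val (by ring)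
  · exact ((((A j).mul (A i)).mul (B j)).cmul _).neg.congr_val (by ring)
  · exact HasDir.const _ x v

theorem hasDir_uBB (m : ℕ) (x v : Fin (2*m+1) → ℝ) (i j : ℕ) :
    HasDir (fun y => uBB (aV m y) (bV m y) i j) x v
      (dBB (aV m x) (bV m x) (aV m v) (bV m v) i j) := by
  have A := hasDir_aV m x v
  have B := hasDir_bV m x v
  unfold uBB dBB
  split_ifs
  · exact ((((A j).mul (A j)).mul ((B i).add (B j))).cmul _).congr_val (by ring)
  · exact ((((A i).mul (A i)).mul ((B j).add (B i))).cmul _).neg.congr_val (by ring)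
  · exact HasDir.const _ x v

theorem hasDir_uAB (m : ℕ) (t : ℝ) (x v : Fin (2*m+1) → ℝ) (i j : ℕ) :
    HasDir (fun y => uAB m t (aV m y) (bV m y) i j) x v
      (dAB m t (aV m x) (bV m x) (aV m v) (bV m v) i j) := by
  have A := hasDir_aV m x v
  have B := hasDir_bV m x v
  have K := ((A i).mul ((((A i).mul (A i)).add ((B j).mul (B j))).add (HasDir.const t x v))).cmul
    (wt m i)
  unfold uAB dAB
  split_ifs
  · exact (K.sub (((A i).mul ((A (j+1)).mul (A (j+1)))).cmul _)).congr_val (by ring)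
  · exact (K.neg.add ((((A j).mul (A j)).mul (A i)).cmul _)).congr_val (by ring)
  · exact ((((A j).mul (A j)).mul (A i)).cmul _).congr_val (by ring)
  · exact ((((A (j+1)).mul (A (j+1))).mul (A i)).cmul _).neg.congr_val (by ring)
  · exact HasDir.const _ x v

theorem hasDir_uM (m : ℕ) (t : ℝ) (x v : Fin (2*m+1) → ℝ) (p q : ℕ) :
    HasDir (fun y => uM m t (aV m y) (bV m y) p q) x v
      (dM m t (aV m x) (bV m x) (aV m v) (bV m v) p q) := by
  unfold uM dM
  split_ifs
  · exact hasDir_uAA _ _ _ _ _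
  · exact hasDir_uAB _ _ _ _ _ _
  · exact (hasDir_uAB _ _ _ _ _ _).neg
  · exact hasDir_uBB _ _ _ _ _

/-- only the coordinates in range matter. -/
theorem dM_congr (m : ℕ) (t : ℝ) (a b c d c' d' : ℕ → ℝ) (p q : ℕ) (hp : p < 2*m+1)
    (hq : q < 2*m+1) (hc : ∀ n, 1 ≤ n → n ≤ m + 1 → c n = c' n)
    (hd : ∀ n, 1 ≤ n → n ≤ m → d n = d' n) :
    dM m t a b c d p q = dM m t a b c' d' p q := by
  unfold dM
  split_ifs
  · unfold dAA
    split_ifs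
    · rw [hc (p+1) (by omega) (by omega), hc (q+1) (by omega) (by omega),
        hd (p+1) (by omega) (by omega)]
    · rw [hc (p+1) (by omega) (by omega), hc (q+1) (by omega) (by omega),
        hd (q+1) (by omega) (by omega)]
    · rfl
  · unfold dAB
    rw [hc (p+1) (by omega) (by omega), hd (q-m) (by omega) (by omega),
      hc (q-m) (by omega) (by omega), hc (q-m+1) (by omega) (by omega)]
  · unfold dAB
    rw [hc (q+1) (by omega) (by omega), hd (p-m) (by omega) (by omega),
      hc (p-m) (by omega) (by omega), hc (p-m+1) (by omega) (by omega)]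
  · unfold dBB
    rw [hc (q-m) (by omega) (by omega), hd (q-m) (by omega) (by omega),
      hc (p-m) (by omega) (by omega), hd (p-m) (by omega) (by omega)]

theorem aV_col (m : ℕ) (t : ℝ) (a b : ℕ → ℝ) (i n : ℕ) (h1 : 1 ≤ n) (h2 : n ≤ m + 1) :
    aV m (fun l => uM m t a b l i) n =
      if i ≤ m then uAA m a b n (i+1) else uAB m t a b n (i-m) := by
  unfold aV
  rw [dif_pos ⟨h1, h2⟩]
  unfold uM
  simp only
  rw [if_pos (by omega), Nat.sub_add_cancel h1]

theorem bV_col (m : ℕ) (t : ℝ) (a b : ℕ → ℝ) (i n : ℕ) (h1 : 1 ≤ n) (h2 : n ≤ m) :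
    bV m (fun l => uM m t a b l i) n =
      if i ≤ m then - uAB m t a b (i+1) n else uBB a b n (i-m) := by
  unfold bV
  rw [dif_pos ⟨h1, h2⟩]
  unfold uM
  simp only
  rw [if_neg (by omega), Nat.add_sub_cancel_left]

/-- one cyclic term of the Jacobi identity, with the sum evaluated. -/
noncomputable def trm (m : ℕ) (t : ℝ) (a b : ℕ → ℝ) (i j k : ℕ) : ℝ :=
  dM m t a b (fun n => if i ≤ m then uAA m a b n (i+1) else uAB m t a b n (i-m))
    (fun n => if i ≤ m then - uAB m t a b (i+1) n else uBB a b n (i-m)) j k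

theorem sum_eq_trm (m : ℕ) (t : ℝ) (x : Fin (2*m+1) → ℝ) (i j k : Fin (2*m+1)) :
    ∑ l : Fin (2*m+1), uM m t (aV m x) (bV m x) l i *
      fderiv ℝ (fun y => uM m t (aV m y) (bV m y) j k) x (Pi.single l 1)
    = trm m t (aV m x) (bV m x) i j k := by
  obtain ⟨L, hL, hv⟩ := hasDir_uM m t x (fun l => uM m t (aV m x) (bV m x) l i) j k
  rw [hL.fderiv]
  unfold trm
  rw [← dM_congr m t _ _ _ _ _ _ j k j.2 k.2 (fun n => aV_col m t (aV m x) (bV m x) i n)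
    (fun n => bV_col m t (aV m x) (bV m x) i n), ← hv]
  conv_rhs => rw [pi_eq_sum_univ' (fun l : Fin (2*m+1) => uM m t (aV m x) (bV m x) l i)]
  rw [map_sum]
  refine Finset.sum_congr rfl fun l _ => ?_
  rw [map_smul, smul_eq_mul]

theorem trm_cyc (m : ℕ) (hm : 3 ≤ m) (t : ℝ) (a b : ℕ → ℝ) (i j k : ℕ)
    (hi : i < 2*m+1) (hj : j < 2*m+1) (hk : k < 2*m+1) :
    trm m t a b i j k + trm m t a b j k i + trm m t a b k i j = 0 := by
  by_cases h1 : i ≤ m <;> by_cases h2 : j ≤ m <;> by_cases h3 : k ≤ m <;>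
    simp only [trm, dM, h1, h2, h3, if_true, if_false]
  · exact jac_aaa m hm t a b (i+1) (j+1) (k+1) (by omega) (by omega) (by omega) (by omega)
      (by omega) (by omega)
  · linarith [jac_aab m hm t a b (i+1) (j+1) (k-m) (by omega) (by omega) (by omega) (by omega)
      (by omega) (by omega)]
  · linarith [jac_aab m hm t a b (k+1) (i+1) (j-m) (by omega) (by omega) (by omega) (by omega)
      (by omega) (by omega)]
  · linarith [jac_abb m hm t a b (i+1) (j-m) (k-m) (by omega) (by omega) (by omega) (by omega)
      (by omega) (by omega)]
  · linarith [jac_aab m hm t a b (j+1) (k+1) (i-m) (by omega) (by omega) (by omega) (by omega)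
      (by omega) (by omega)]
  · linarith [jac_abb m hm t a b (j+1) (k-m) (i-m) (by omega) (by omega) (by omega) (by omega)
      (by omega) (by omega)]
  · linarith [jac_abb m hm t a b (k+1) (i-m) (j-m) (by omega) (by omega) (by omega) (by omega)
      (by omega) (by omega)]
  · exact jac_bbb m hm t a b (i-m) (j-m) (k-m) (by omega) (by omega) (by omega) (by omega)
      (by omega) (by omega)

/-- the cubic tensor `π₃` is Poisson, and `π₁` and `π₃` are compatible
(`π₁ + π₃` also satisfies the Jacobi identity). -/
theorem pi3_poisson_and_compatible (m : ℕ) (hm : 3 ≤ m) (x : Fin (2*m+1) → ℝ)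
    (i j k : Fin (2*m+1)) :
    (∑ l : Fin (2*m+1),
      (pi3M m x l i * fderiv ℝ (fun y => pi3M m y j k) x (Pi.single l 1)
        + pi3M m x l j * fderiv ℝ (fun y => pi3M m y k i) x (Pi.single l 1)
        + pi3M m x l k * fderiv ℝ (fun y => pi3M m y i j) x (Pi.single l 1)) = 0) ∧
    (∑ l : Fin (2*m+1),
      ((pi1M m x l i + pi3M m x l i) *
          fderiv ℝ (fun y => pi1M m y j k + pi3M m y j k) x (Pi.single l 1)
        + (pi1M m x l j + pi3M m x l j) *
          fderiv ℝ (fun y => pi1M m y k i + pi3M m y k i) x (Pi.single l 1)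
        + (pi1M m x l k + pi3M m x l k) *
          fderiv ℝ (fun y => pi1M m y i j + pi3M m y i j) x (Pi.single l 1)) = 0) := by
  have e3 : ∀ (y : Fin (2*m+1) → ℝ) (p q : Fin (2*m+1)),
      pi3M m y p q = uM m 0 (aV m y) (bV m y) p q := fun y p q => (pi3M_eq m hm y p q).1
  have e13 : ∀ (y : Fin (2*m+1) → ℝ) (p q : Fin (2*m+1)),
      pi1M m y p q + pi3M m y p q = uM m (1/2) (aV m y) (bV m y) p q :=
    fun y p q => (pi3M_eq m hm y p q).2
  constructor
  · simp only [e3, Finset.sum_add_distrib, sum_eq_trm]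
    exact trm_cyc m hm _ _ _ i j k i.2 j.2 k.2
  · simp only [e13, Finset.sum_add_distrib, sum_eq_trm]
    exact trm_cyc m hm _ _ _ i j k i.2 j.2 k.2
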